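/- Assume 0 < l ≤ c and μ > r(c−l). For an integer n ≥ 0, suppose t_n ≥ 0 and t_{n+1} ≥ 0 satisfy B_n(t_n) = 0 and B_{n+1}(t_{n+1}) = 0 (the maximal lead-time quotes that leave the marginal customer indifferent in states n and n+1). Then t_{n+1} ≤ t_n, and G_{n+1}(t_{n+1}) ≤ G_n(t_n). -/

import Mathlib

open MeasureTheory

/-- Density of the Gamma(n+1, μ) distribution: f_{n,μ}(x) = μ^{n+1} x^n e^{-μx} / n!. -/
noncomputable def gpdf (n : ℕ) (μ x : ℝ) : ℝ :=
  μ ^ (n + 1) * x ^ n * Real.exp (-(μ * x)) / (n.factorial : ℝ)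

/-- Expected CARA utility of a customer quoted lead-time `d` who joins when `n`
customers are present. -/
noncomputable def Bn (R p c l r μ : ℝ) (n : ℕ) (d : ℝ) : ℝ :=
  (∫ x in (0:ℝ)..d, (1 - Real.exp (-(r * (R - p - c * x)))) / r * gpdf n μ x)
  + ∫ x in Set.Ioi d,
      (1 - Real.exp (-(r * (R - p - l * d - (c - l) * x)))) / r * gpdf n μ x

/-- Expected lateness beyond the quoted lead-time `d` in state `n`. -/
noncomputable def Ln (μ : ℝ) (n : ℕ) (d : ℝ) : ℝ :=
  ∫ x in Set.Ioi d, (x - d) * gpdf n μ x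

/-- Provider expected profit from a joining customer in state `n` under quote `d`. -/
noncomputable def Gn (p l μ : ℝ) (n : ℕ) (d : ℝ) : ℝ := p - l * Ln μ n d

/-- CARA utility of a customer quoted lead-time `d` who waits `x`, where `V` is the net value. -/
noncomputable def caraUtility (V c l r d x : ℝ) : ℝ :=
  (1 - Real.exp (-(r * (V - c * x + l * max (x - d) 0)))) / r

theorem caraUtility_antitone {c l r : ℝ} (hl : 0 ≤ l) (hlc : l ≤ c) (hr : 0 < r) (V d : ℝ) :
    Antitone (caraUtility V c l r d) := by
  intro x y hxy
  unfold caraUtility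
  have hmax : max (y - d) 0 ≤ max (x - d) 0 + (y - x) :=
    max_le (by linarith [le_max_left (x - d) 0]) (by linarith [le_max_right (x - d) 0])
  have hnet : V - c * y + l * max (y - d) 0 ≤ V - c * x + l * max (x - d) 0 := by
    nlinarith [mul_le_mul_of_nonneg_left hmax hl,
      mul_le_mul_of_nonneg_right hlc (sub_nonneg.mpr hxy)]
  gcongr

theorem caraUtility_antitone_quote {l r : ℝ} (hl : 0 ≤ l) (hr : 0 < r) (V c x : ℝ) :
    Antitone fun d => caraUtility V c l r d x := by
  intro d e hde
  dsimp only [caraUtility]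
  gcongr

theorem caraUtility_lt_of_quote_lt {l r d e x : ℝ} (hl : 0 < l) (hr : 0 < r) (V c : ℝ)
    (hde : d < e) (hdx : d < x) : caraUtility V c l r e x < caraUtility V c l r d x := by
  have hmax : max (x - e) 0 < max (x - d) 0 :=
    max_lt (lt_max_of_lt_left (by linarith)) (lt_max_of_lt_left (by linarith))
  unfold caraUtility
  gcongr

theorem gpdf_pos {μ x : ℝ} (hμ : 0 < μ) (hx : 0 < x) (n : ℕ) : 0 < gpdf n μ x := by
  unfold gpdf
  positivity

theorem gpdf_succ (n : ℕ) (μ x : ℝ) : gpdf (n + 1) μ x = gpdf n μ x * (μ * x / (n + 1)) := by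
  unfold gpdf
  rw [Nat.factorial_succ]
  push_cast
  have : (n.factorial : ℝ) ≠ 0 := by positivity
  field_simp
  ring

theorem continuous_gpdf (n : ℕ) (μ : ℝ) : Continuous (gpdf n μ) := by
  unfold gpdf
  fun_prop

theorem integrableOn_gpdf {μ : ℝ} (hμ : 0 < μ) (n : ℕ) :
    IntegrableOn (gpdf n μ) (Set.Ioi 0) := by
  have h := integrableOn_rpow_mul_exp_neg_mul_rpow (s := n) (p := 1) (b := μ)
    (by linarith [n.cast_nonneg (α := ℝ)]) one_pos hμ
  refine (h.const_mul (μ ^ (n + 1) / n.factorial)).congr ?_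
  refine Filter.Eventually.of_forall fun x => ?_
  simp only [gpdf, Real.rpow_natCast, Real.rpow_one, neg_mul]
  ring

theorem integral_gpdf {μ : ℝ} (hμ : 0 < μ) (n : ℕ) :
    ∫ x in Set.Ioi 0, gpdf n μ x = 1 := by
  have h := Real.integral_rpow_mul_exp_neg_mul_Ioi (a := n + 1) (r := μ) (by positivity) hμ
  have hfun : gpdf n μ = fun x => μ ^ (n + 1) / n.factorial *
      (x ^ ((n : ℝ) + 1 - 1) * Real.exp (-(μ * x))) := by
    funext x
    simp only [gpdf, add_sub_cancel_right, Real.rpow_natCast]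
    ring
  rw [hfun, integral_const_mul, h, Real.Gamma_nat_eq_factorial]
  have hpow : (1 / μ) ^ ((n : ℝ) + 1) = (1 / μ) ^ (n + 1) := by
    rw [← Real.rpow_natCast]
    push_cast
    rfl
  have : (n.factorial : ℝ) ≠ 0 := by positivity
  rw [hpow, one_div, inv_pow]
  field_simp

theorem integrableOn_exp_mul_gpdf {μ a : ℝ} (ha : a < μ) (n : ℕ) :
    IntegrableOn (fun x => Real.exp (a * x) * gpdf n μ x) (Set.Ioi 0) := by
  have hpos : 0 < μ - a := sub_pos.mpr ha
  refine ((integrableOn_gpdf hpos n).const_mul (μ ^ (n + 1) / (μ - a) ^ (n + 1))).congr ?_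
  refine Filter.Eventually.of_forall fun x => ?_
  have hexp : Real.exp (-((μ - a) * x)) = Real.exp (a * x) * Real.exp (-(μ * x)) := by
    rw [← Real.exp_add]
    ring_nf
  simp only [gpdf, hexp]
  field_simp

theorem integrableOn_id_mul_gpdf {μ : ℝ} (hμ : 0 < μ) (n : ℕ) :
    IntegrableOn (fun x => x * gpdf n μ x) (Set.Ioi 0) := by
  refine ((integrableOn_gpdf hμ (n + 1)).const_mul ((n + 1) / μ)).congr ?_
  refine Filter.Eventually.of_forall fun x => ?_
  simp only [gpdf_succ]
  field_simp

theorem integrableOn_caraUtility_mul_gpdf {c l r μ : ℝ} (hl : 0 ≤ l) (hr : 0 < r) (hμ0 : 0 < μ)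
    (hμ : r * (c - l) < μ) (V d : ℝ) (n : ℕ) :
    IntegrableOn (fun x => caraUtility V c l r d x * gpdf n μ x) (Set.Ioi 0) := by
  have hbound : IntegrableOn (fun x => Real.exp (-(r * (V - l * d))) *
      (Real.exp (r * (c - l) * x) * gpdf n μ x)) (Set.Ioi 0) :=
    (integrableOn_exp_mul_gpdf hμ n).const_mul _
  have hexp : IntegrableOn (fun x => Real.exp (-(r * (V - c * x + l * max (x - d) 0))) *
      gpdf n μ x) (Set.Ioi 0) := by
    refine Integrable.mono' hbound ?_ ?_
    · have := continuous_gpdf n μ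
      exact Continuous.aestronglyMeasurable (by fun_prop)
    · filter_upwards [ae_restrict_mem measurableSet_Ioi] with x hx
      have hg := gpdf_pos hμ0 hx n
      rw [Real.norm_of_nonneg (by positivity), ← mul_assoc, ← Real.exp_add]
      gcongr
      nlinarith [mul_le_mul_of_nonneg_left (le_max_left (x - d) 0) (mul_nonneg hr.le hl)]
  refine (((integrableOn_gpdf hμ0 n).sub hexp).div_const r).congr ?_
  refine Filter.Eventually.of_forall fun x => ?_
  simp only [caraUtility, Pi.sub_apply]
  ring

theorem integrableOn_max_sub_mul_gpdf {μ : ℝ} (hμ : 0 < μ) {d : ℝ} (hd : 0 ≤ d) (n : ℕ) :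
    IntegrableOn (fun x => max (x - d) 0 * gpdf n μ x) (Set.Ioi 0) := by
  refine Integrable.mono' (integrableOn_id_mul_gpdf hμ n) ?_ ?_
  · have := continuous_gpdf n μ
    exact Continuous.aestronglyMeasurable (by fun_prop)
  · filter_upwards [ae_restrict_mem measurableSet_Ioi] with x hx
    have hxd : 0 < x := hx
    have hg := gpdf_pos hμ hx n
    rw [Real.norm_of_nonneg (mul_nonneg (le_max_right _ _) hg.le)]
    gcongr
    exact max_le (by linarith) hxd.le

/-- Gamma distributions of consecutive shapes are stochastically ordered: the difference of the
densities changes sign once, from negative to positive. -/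
theorem integral_mul_gpdf_le_succ {μ : ℝ} (hμ : 0 < μ) {n : ℕ} {φ : ℝ → ℝ} (hφ : Monotone φ)
    (hn : IntegrableOn (fun x => φ x * gpdf n μ x) (Set.Ioi 0))
    (hn' : IntegrableOn (fun x => φ x * gpdf (n + 1) μ x) (Set.Ioi 0)) :
    ∫ x in Set.Ioi 0, φ x * gpdf n μ x ≤ ∫ x in Set.Ioi 0, φ x * gpdf (n + 1) μ x := by
  set x₀ : ℝ := (n + 1) / μ with hx₀
  have hi := (integrableOn_gpdf hμ n).const_mul (φ x₀)
  have hi' := (integrableOn_gpdf hμ (n + 1)).const_mul (φ x₀)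
  have hle : ∫ x in Set.Ioi 0, (φ x * gpdf n μ x - φ x₀ * gpdf n μ x) ≤
      ∫ x in Set.Ioi 0, (φ x * gpdf (n + 1) μ x - φ x₀ * gpdf (n + 1) μ x) := by
    refine setIntegral_mono_on (hn.sub hi) (hn'.sub hi') measurableSet_Ioi fun x hx => ?_
    have hg := gpdf_pos hμ hx n
    have hratio : μ * x / (n + 1) - 1 = μ / (n + 1) * (x - x₀) := by
      rw [hx₀]
      field_simp
    have hsign : 0 ≤ (φ x - φ x₀) * (x - x₀) := by
      rcases le_total x x₀ with h | h
      · exact mul_nonneg_of_nonpos_of_nonpos (sub_nonpos.mpr (hφ h)) (sub_nonpos.mpr h)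
      · exact mul_nonneg (sub_nonneg.mpr (hφ h)) (sub_nonneg.mpr h)
    have hmul : 0 ≤ gpdf n μ x * (μ / (n + 1)) * ((φ x - φ x₀) * (x - x₀)) := by positivity
    have heq : (φ x * gpdf (n + 1) μ x - φ x₀ * gpdf (n + 1) μ x) -
        (φ x * gpdf n μ x - φ x₀ * gpdf n μ x) =
        gpdf n μ x * (φ x - φ x₀) * (μ * x / (n + 1) - 1) := by
      rw [gpdf_succ]
      ring
    rw [hratio] at heq
    linarith
  rw [integral_sub hn hi, integral_sub hn' hi', integral_const_mul, integral_const_mul,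
    integral_gpdf hμ, integral_gpdf hμ] at hle
  linarith

theorem Bn_eq_integral_caraUtility {c l r μ d : ℝ} (hl : 0 ≤ l) (hr : 0 < r) (hμ0 : 0 < μ)
    (hμ : r * (c - l) < μ) (hd : 0 ≤ d) (R p : ℝ) (n : ℕ) :
    Bn R p c l r μ n d = ∫ x in Set.Ioi 0, caraUtility (R - p) c l r d x * gpdf n μ x := by
  have hint := integrableOn_caraUtility_mul_gpdf hl hr hμ0 hμ (R - p) d n
  rw [← intervalIntegral.integral_interval_add_Ioi hint
    (hint.mono_set (Set.Ioi_subset_Ioi hd))]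
  unfold Bn
  congr 1
  · refine intervalIntegral.integral_congr fun x hx => ?_
    rw [Set.uIcc_of_le hd] at hx
    simp [caraUtility, max_eq_right (sub_nonpos.mpr hx.2)]
  · refine setIntegral_congr_fun measurableSet_Ioi fun x hx => ?_
    have hxd : d < x := hx
    simp only [caraUtility, max_eq_left (sub_nonneg.mpr hxd.le)]
    ring_nf

theorem Ln_eq_integral_max {μ d : ℝ} (hμ : 0 < μ) (hd : 0 ≤ d) (n : ℕ) :
    Ln μ n d = ∫ x in Set.Ioi 0, max (x - d) 0 * gpdf n μ x := by
  have hint := integrableOn_max_sub_mul_gpdf hμ hd n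
  rw [← intervalIntegral.integral_interval_add_Ioi hint
    (hint.mono_set (Set.Ioi_subset_Ioi hd))]
  have hzero : ∫ x in (0 : ℝ)..d, max (x - d) 0 * gpdf n μ x = ∫ _ in (0 : ℝ)..d, (0 : ℝ) := by
    refine intervalIntegral.integral_congr fun x hx => ?_
    rw [Set.uIcc_of_le hd] at hx
    simp [max_eq_right (sub_nonpos.mpr hx.2)]
  rw [hzero, intervalIntegral.integral_zero, zero_add]
  unfold Ln
  refine setIntegral_congr_fun measurableSet_Ioi fun x hx => ?_
  have hxd : d < x := hx
  simp only [max_eq_left (sub_nonneg.mpr hxd.le)]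

theorem Bn_succ_le {c l r μ d : ℝ} (hl : 0 ≤ l) (hlc : l ≤ c) (hr : 0 < r) (hμ0 : 0 < μ)
    (hμ : r * (c - l) < μ) (hd : 0 ≤ d) (R p : ℝ) (n : ℕ) :
    Bn R p c l r μ (n + 1) d ≤ Bn R p c l r μ n d := by
  have hint := integrableOn_caraUtility_mul_gpdf hl hr hμ0 hμ (R - p) d
  have h := integral_mul_gpdf_le_succ hμ0 (n := n) (caraUtility_antitone hl hlc hr (R - p) d).neg
    (by simpa [neg_mul] using (hint n).neg) (by simpa [neg_mul] using (hint (n + 1)).neg)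
  simp only [neg_mul, integral_neg] at h
  rw [Bn_eq_integral_caraUtility hl hr hμ0 hμ hd, Bn_eq_integral_caraUtility hl hr hμ0 hμ hd]
  linarith

theorem Bn_strictAntiOn {c l r μ : ℝ} (hl : 0 < l) (hr : 0 < r) (hμ0 : 0 < μ)
    (hμ : r * (c - l) < μ) (R p : ℝ) (n : ℕ) :
    StrictAntiOn (Bn R p c l r μ n) (Set.Ici 0) := by
  intro d hd e he hde
  have hint := fun q => integrableOn_caraUtility_mul_gpdf hl.le hr hμ0 hμ (R - p) q n
  rw [Bn_eq_integral_caraUtility hl.le hr hμ0 hμ hd, Bn_eq_integral_caraUtility hl.le hr hμ0 hμ he,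
    ← sub_pos, ← integral_sub (hint d) (hint e)]
  refine (setIntegral_pos_iff_support_of_nonneg_ae ?_ ((hint d).sub (hint e))).mpr ?_
  · filter_upwards [ae_restrict_mem measurableSet_Ioi] with x hx
    rw [Pi.zero_apply, Pi.sub_apply, ← sub_mul]
    exact mul_nonneg (sub_nonneg.mpr (caraUtility_antitone_quote hl.le hr _ c x hde.le))
      (gpdf_pos hμ0 hx n).le
  · refine lt_of_lt_of_le ?_ (measure_mono (s := Set.Ioi d) fun x hx => ?_)
    · simp
    · have hx0 : 0 < x := lt_of_le_of_lt hd hx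
      refine ⟨?_, hx0⟩
      rw [Function.mem_support, Pi.sub_apply, ← sub_mul]
      exact (mul_pos (sub_pos.mpr (caraUtility_lt_of_quote_lt hl hr _ c hde hx))
        (gpdf_pos hμ0 hx0 n)).ne'

theorem Ln_le_succ {μ d : ℝ} (hμ : 0 < μ) (hd : 0 ≤ d) (n : ℕ) :
    Ln μ n d ≤ Ln μ (n + 1) d := by
  rw [Ln_eq_integral_max hμ hd, Ln_eq_integral_max hμ hd]
  refine integral_mul_gpdf_le_succ hμ (φ := fun x => max (x - d) 0) (fun x y hxy => ?_)
    (integrableOn_max_sub_mul_gpdf hμ hd n) (integrableOn_max_sub_mul_gpdf hμ hd (n + 1))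
  dsimp only
  gcongr

theorem Ln_antitoneOn {μ : ℝ} (hμ : 0 < μ) (n : ℕ) : AntitoneOn (Ln μ n) (Set.Ici 0) := by
  intro d hd e he hde
  rw [Ln_eq_integral_max hμ hd, Ln_eq_integral_max hμ he]
  refine setIntegral_mono_on (integrableOn_max_sub_mul_gpdf hμ he n)
    (integrableOn_max_sub_mul_gpdf hμ hd n) measurableSet_Ioi fun x hx => ?_
  have hg := gpdf_pos hμ hx n
  gcongr

/-- The indifference lead-times are nonincreasing in the state, and so is the
provider profit evaluated at them. -/
theorem indifference_quotes_monotone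
    (R p c l r μ : ℝ) (hpR : p ≤ R) (hc : 0 < c) (hl0 : 0 < l) (hlc : l ≤ c)
    (hr : 0 < r) (hμ0 : 0 < μ) (hμ : r * (c - l) < μ) (n : ℕ)
    (t t' : ℝ) (ht0 : 0 ≤ t) (ht'0 : 0 ≤ t')
    (ht : Bn R p c l r μ n t = 0) (ht' : Bn R p c l r μ (n + 1) t' = 0) :
    t' ≤ t ∧ Gn p l μ (n + 1) t' ≤ Gn p l μ n t := by
  have htt' : t' ≤ t := by
    by_contra! hlt
    have hstrict := Bn_strictAntiOn hl0 hr hμ0 hμ R p (n + 1) ht0 ht'0 hlt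
    have hsucc := Bn_succ_le hl0.le hlc hr hμ0 hμ ht0 R p n
    linarith
  refine ⟨htt', ?_⟩
  have hL : Ln μ n t ≤ Ln μ (n + 1) t' :=
    (Ln_le_succ hμ0 ht0 n).trans (Ln_antitoneOn hμ0 (n + 1) ht'0 ht0 htt')
  unfold Gn
  gcongr
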